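/- arXiv:1805.11960 — 5 statements merged into one kernel-verified Lean document; each statement's English description precedes it below -/
import Mathlib

section
/- For a Tychonoff space X, the following are equivalent: (1) C_p(X) satisfies F_fin(Γ_0, Ω_0); (2) X satisfies U_fin(Γ_F, Ω). -/
open Set Filter Topology

universe u

/-- A zero-set: the preimage of `{0}` under some continuous real-valued function. -/
def IsZeroSet {X : Type u} [TopologicalSpace X] (Z : Set X) : Prop :=
  ∃ f : X → ℝ, Continuous f ∧ Z = f ⁻¹' {0}

/-- A cozero-set: the complement of a zero-set. -/
def IsCozeroSet {X : Type u} [TopologicalSpace X] (U : Set X) : Prop :=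
  IsZeroSet Uᶜ

/-- A γ-cover (no openness requirement): an infinite nontrivial cover such that every
point belongs to all but finitely many members. -/
def IsGammaCoverSets {X : Type u} (𝒰 : Set (Set X)) : Prop :=
  (univ : Set X) ∉ 𝒰 ∧ 𝒰.Infinite ∧ ⋃₀ 𝒰 = (univ : Set X) ∧
    ∀ x : X, {U ∈ 𝒰 | x ∉ U}.Finite

/-- An open γ-cover. -/
def IsOpenGammaCover {X : Type u} [TopologicalSpace X] (𝒰 : Set (Set X)) : Prop :=
  (∀ U ∈ 𝒰, IsOpen U) ∧ IsGammaCoverSets 𝒰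

/-- A γ_F-shrinkable γ-cover: a γ-cover of cozero-sets admitting a shrinking by zero-sets
which is again a γ-cover. -/
def IsGammaFCover {X : Type u} [TopologicalSpace X] (𝒰 : Set (Set X)) : Prop :=
  IsOpenGammaCover 𝒰 ∧ (∀ U ∈ 𝒰, IsCozeroSet U) ∧
    ∃ F : Set X → Set X, (∀ U ∈ 𝒰, IsZeroSet (F U) ∧ F U ⊆ U) ∧
      IsGammaCoverSets (F '' 𝒰)

/-- An ω-cover: a nontrivial open cover such that every finite subset of the space is
contained in some member. -/
def IsOmegaCover {X : Type u} [TopologicalSpace X] (𝒰 : Set (Set X)) : Prop :=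
  (∀ U ∈ 𝒰, IsOpen U) ∧ (univ : Set X) ∉ 𝒰 ∧ ⋃₀ 𝒰 = (univ : Set X) ∧
    ∀ K : Set X, K.Finite → ∃ U ∈ 𝒰, K ⊆ U

/-- The family contains a finite subcover. -/
def HasFinSubcover {X : Type u} (𝒰 : Set (Set X)) : Prop :=
  ∃ 𝓕 ⊆ 𝒰, 𝓕.Finite ∧ ⋃₀ 𝓕 = (univ : Set X)

/-- `U_fin(Γ_F, Ω)`. -/
def UfinGammaFOmega (X : Type u) [TopologicalSpace X] : Prop :=
  ∀ 𝒰 : ℕ → Set (Set X), (∀ n, IsGammaFCover (𝒰 n)) →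
    (∀ n, ¬ HasFinSubcover (𝒰 n)) →
    ∃ 𝓕 : ℕ → Set (Set X), (∀ n, 𝓕 n ⊆ 𝒰 n ∧ (𝓕 n).Finite) ∧
      IsOmegaCover (Set.range fun n => ⋃₀ 𝓕 n)

/-- `U_fin(Γ_F, Γ)`. -/
def UfinGammaFGamma (X : Type u) [TopologicalSpace X] : Prop :=
  ∀ 𝒰 : ℕ → Set (Set X), (∀ n, IsGammaFCover (𝒰 n)) →
    (∀ n, ¬ HasFinSubcover (𝒰 n)) →
    ∃ 𝓕 : ℕ → Set (Set X), (∀ n, 𝓕 n ⊆ 𝒰 n ∧ (𝓕 n).Finite) ∧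
      IsOpenGammaCover (Set.range fun n => ⋃₀ 𝓕 n)

/-- `U_fin(𝒪, Ω)`. -/
def UfinOOmega (X : Type u) [TopologicalSpace X] : Prop :=
  ∀ 𝒰 : ℕ → Set (Set X),
    (∀ n, (∀ U ∈ 𝒰 n, IsOpen U) ∧ ⋃₀ 𝒰 n = (univ : Set X)) →
    (∀ n, ¬ HasFinSubcover (𝒰 n)) →
    ∃ 𝓕 : ℕ → Set (Set X), (∀ n, 𝓕 n ⊆ 𝒰 n ∧ (𝓕 n).Finite) ∧
      IsOmegaCover (Set.range fun n => ⋃₀ 𝓕 n)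

/-- The Hurewicz property `U_fin(𝒪, Γ)`. -/
def HurewiczProperty (X : Type u) [TopologicalSpace X] : Prop :=
  ∀ 𝒰 : ℕ → Set (Set X),
    (∀ n, (∀ U ∈ 𝒰 n, IsOpen U) ∧ ⋃₀ 𝒰 n = (univ : Set X)) →
    ∃ 𝓕 : ℕ → Set (Set X), (∀ n, 𝓕 n ⊆ 𝒰 n ∧ (𝓕 n).Finite) ∧
      ∀ x : X, {n : ℕ | x ∉ ⋃₀ 𝓕 n}.Finite

/- Function space notions.  `C_p(X)` is the set of continuous functions `X → ℝ` with
the topology of pointwise convergence, i.e. the topology inherited from the product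
topology on `X → ℝ` (the default `Pi` topology instance). -/

/-- A sequentially dense subset of `C_p(X)`: every continuous function is the pointwise
limit of a sequence from `D`. -/
def SeqDenseCp {X : Type u} [TopologicalSpace X] (D : Set (X → ℝ)) : Prop :=
  (∀ f ∈ D, Continuous f) ∧ ∀ f : X → ℝ, Continuous f →
    ∃ g : ℕ → X → ℝ, (∀ n, g n ∈ D) ∧ Tendsto g atTop (𝓝 f)

/-- A dense subset of `C_p(X)`: every neighborhood (in the topology of pointwise
convergence) of every continuous function meets `D`. -/
def DenseCp {X : Type u} [TopologicalSpace X] (D : Set (X → ℝ)) : Prop :=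
  (∀ f ∈ D, Continuous f) ∧ ∀ f : X → ℝ, Continuous f →
    ∀ U ∈ 𝓝 f, (U ∩ D).Nonempty

/-- `C_p(X)` is separable. -/
def CpSeparable (X : Type u) [TopologicalSpace X] : Prop :=
  ∃ D : Set (X → ℝ), D.Countable ∧ DenseCp D

/-- `C_p(X)` is sequentially separable. -/
def CpSeqSeparable (X : Type u) [TopologicalSpace X] : Prop :=
  ∃ D : Set (X → ℝ), D.Countable ∧ SeqDenseCp D

/-- `A ∈ Γ_0`: a countable set of continuous functions, not containing `0`, infinite,
converging to `0` (every neighborhood of `0` in the topology of pointwise convergence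
contains all but finitely many elements of `A`). -/
def GammaZero {X : Type u} [TopologicalSpace X] (A : Set (X → ℝ)) : Prop :=
  A.Countable ∧ (∀ f ∈ A, Continuous f) ∧ (0 : X → ℝ) ∉ A ∧ A.Infinite ∧
    ∀ U ∈ 𝓝 (0 : X → ℝ), (A \ U).Finite

/-- `C_p(X)` satisfies `F_fin(𝒮, 𝒟)`. -/
def FfinSD (X : Type u) [TopologicalSpace X] : Prop :=
  ∀ S : ℕ → Set (X → ℝ), (∀ n, SeqDenseCp (S n)) →
    ∃ F : ℕ → Set (X → ℝ), (∀ n, F n ⊆ S n ∧ (F n).Finite) ∧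
      ∀ f : X → ℝ, Continuous f → ∀ ε : ℝ, 0 < ε → ∀ K : Set X, K.Finite →
        ∃ n : ℕ, ∀ x ∈ K, ∃ h ∈ F n, |f x - h x| < ε

/-- `C_p(X)` satisfies `F_fin(Γ_0, Ω_0)`. -/
def FfinGammaOmega (X : Type u) [TopologicalSpace X] : Prop :=
  ∀ S : ℕ → Set (X → ℝ), (∀ n, GammaZero (S n)) →
    ∃ F : ℕ → Set (X → ℝ), (∀ n, F n ⊆ S n ∧ (F n).Finite) ∧
      ∀ ε : ℝ, 0 < ε → ∀ K : Set X, K.Finite →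
        ∃ n : ℕ, ∀ x ∈ K, ∃ h ∈ F n, |h x| < ε

/-- `C_p(X)` satisfies `F_fin(𝒮, Ω_0)`. -/
def FfinSOmega (X : Type u) [TopologicalSpace X] : Prop :=
  ∀ S : ℕ → Set (X → ℝ), (∀ n, SeqDenseCp (S n)) →
    ∃ F : ℕ → Set (X → ℝ), (∀ n, F n ⊆ S n ∧ (F n).Finite) ∧
      ∀ ε : ℝ, 0 < ε → ∀ K : Set X, K.Finite →
        ∃ n : ℕ, ∀ x ∈ K, ∃ h ∈ F n, |h x| < ε

/-- `C_p(X)` satisfies `F_fin(𝒮, 𝒮)`. -/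
def FfinSS (X : Type u) [TopologicalSpace X] : Prop :=
  ∀ S : ℕ → Set (X → ℝ), (∀ n, SeqDenseCp (S n)) →
    ∃ F : ℕ → Set (X → ℝ), (∀ n, F n ⊆ S n ∧ (F n).Finite) ∧
      ∀ f : X → ℝ, Continuous f → ∀ ε : ℝ, 0 < ε → ∀ K : Set X, K.Finite →
        ∃ n' : ℕ, ∀ n : ℕ, n' < n → ∀ x ∈ K, ∃ h ∈ F n, |f x - h x| < ε

/-- `C_p(X)` satisfies `F_fin(Γ_0, Γ_0)`. -/
def FfinGammaGamma (X : Type u) [TopologicalSpace X] : Prop :=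
  ∀ S : ℕ → Set (X → ℝ), (∀ n, GammaZero (S n)) →
    ∃ F : ℕ → Set (X → ℝ), (∀ n, F n ⊆ S n ∧ (F n).Finite) ∧
      ∀ ε : ℝ, 0 < ε → ∀ K : Set X, K.Finite →
        ∃ n' : ℕ, ∀ n : ℕ, n' < n → ∀ x ∈ K, ∃ h ∈ F n, |h x| < ε

/-- `C_p(X)` satisfies `F_fin(𝒮, Γ_0)`. -/
def FfinSGamma (X : Type u) [TopologicalSpace X] : Prop :=
  ∀ S : ℕ → Set (X → ℝ), (∀ n, SeqDenseCp (S n)) →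
    ∃ F : ℕ → Set (X → ℝ), (∀ n, F n ⊆ S n ∧ (F n).Finite) ∧
      ∀ ε : ℝ, 0 < ε → ∀ K : Set X, K.Finite →
        ∃ n' : ℕ, ∀ n : ℕ, n' < n → ∀ x ∈ K, ∃ h ∈ F n, |h x| < ε

/-- `iw(X) = ℵ₀`: there is a continuous bijection from `X` onto a second-countable
Tychonoff space. -/
def IWCountable (X : Type u) [TopologicalSpace X] : Prop :=
  ∃ (Y : Type u) (tY : TopologicalSpace Y),
    @SecondCountableTopology Y tY ∧ @CompletelyRegularSpace Y tY ∧ @T2Space Y tY ∧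
    ∃ f : X → Y, @Continuous X Y _ tY f ∧ Function.Bijective f

/-- The Velichko property `X ⊨ V`: there is a continuous bijection onto a separable
metrizable space sending every cozero-set to an `F_σ`-set. -/
def VelichkoProperty (X : Type u) [TopologicalSpace X] : Prop :=
  ∃ (Y : Type u) (tY : TopologicalSpace Y),
    @TopologicalSpace.MetrizableSpace Y tY ∧ @TopologicalSpace.SeparableSpace Y tY ∧
    ∃ f : X → Y, @Continuous X Y _ tY f ∧ Function.Bijective f ∧
      ∀ U : Set X, IsCozeroSet U →
        ∃ Z : ℕ → Set Y, (∀ n, @IsClosed Y tY (Z n)) ∧ f '' U = ⋃ n, Z n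

/-- Convergence of an infinite set to `0` in the topology of pointwise convergence, tested at
single points. -/
theorem forall_nhds_zero_finite_diff_iff {X : Type u} {A : Set (X → ℝ)} :
    (∀ U ∈ 𝓝 (0 : X → ℝ), (A \ U).Finite) ↔
      ∀ x : X, ∀ ε : ℝ, 0 < ε → {f ∈ A | ¬ |f x| < ε}.Finite := by
  have key : (∀ U ∈ 𝓝 (0 : X → ℝ), (A \ U).Finite) ↔
      Tendsto (fun f : X → ℝ => f) (cofinite ⊓ 𝓟 A) (𝓝 0) := by
    refine forall₂_congr fun U _ => ?_
    rw [mem_map, mem_inf_principal, mem_cofinite]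
    refine iff_of_eq (congrArg _ ?_)
    ext f
    simp
  rw [key, tendsto_pi_nhds]
  refine forall_congr' fun x => ?_
  rw [Metric.tendsto_nhds]
  refine forall₂_congr fun ε _ => ?_
  rw [eventually_inf_principal, eventually_cofinite]
  simp

theorem isZeroSet_setOf_le {X : Type u} [TopologicalSpace X] {f g : X → ℝ} (hf : Continuous f)
    (hg : Continuous g) : IsZeroSet {x | f x ≤ g x} := by
  refine ⟨fun x => max (f x - g x) 0, by fun_prop, ?_⟩
  ext x
  simp

/-- A zero-set inside a cozero-set is separated from its complement by a continuous function,
vanishing exactly on the zero-set and less than `1` only on the cozero-set. -/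
theorem IsZeroSet.exists_separating {X : Type u} [TopologicalSpace X] {Z U : Set X}
    (hZ : IsZeroSet Z) (hU : IsCozeroSet U) (hZU : Z ⊆ U) :
    ∃ φ : X → ℝ, Continuous φ ∧ (∀ x, φ x = 0 ↔ x ∈ Z) ∧ ∀ x, |φ x| < 1 → x ∈ U := by
  obtain ⟨f, hf, rfl⟩ := hZ
  obtain ⟨g, hg, hgU⟩ := hU
  have hmem : ∀ x, x ∉ U ↔ g x = 0 := fun x => by
    rw [← mem_compl_iff, hgU]
    rfl
  have hpos : ∀ x, |f x| + |g x| ≠ 0 := fun x h => by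
    have hf0 : f x = 0 := abs_eq_zero.1 (by linarith [abs_nonneg (f x), abs_nonneg (g x)])
    have hg0 : g x = 0 := abs_eq_zero.1 (by linarith [abs_nonneg (f x), abs_nonneg (g x)])
    exact (hmem x).2 hg0 (hZU hf0)
  refine ⟨fun x => |f x| / (|f x| + |g x|), hf.abs.div (hf.abs.add hg.abs) hpos,
    fun x => by simp [hpos x], fun x hx => ?_⟩
  by_contra hxU
  have hg0 := (hmem x).1 hxU
  have hf0 : |f x| ≠ 0 := by simpa [hg0] using hpos x
  simp [hg0, div_self hf0] at hx

/-- A `γ_F`-shrinkable cover yields an infinite set of functions converging to `0` whose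
open sublevel sets refine the cover. -/
theorem IsGammaFCover.exists_gammaZero {X : Type u} [TopologicalSpace X] {𝒰 : Set (Set X)}
    (h : IsGammaFCover 𝒰) :
    ∃ S : Set (X → ℝ), GammaZero S ∧ ∀ f ∈ S, ∃ U ∈ 𝒰, ∀ x, |f x| < 1 → x ∈ U := by
  obtain ⟨⟨-, huniv, -⟩, hcoz, F, hF, -, hFinf, -, hFfin⟩ := h
  obtain ⟨t, htsub, htbij⟩ := exists_subset_bijOn 𝒰 F
  have htinf : t.Infinite := fun hfin => hFinf (htbij.image_eq ▸ hfin.image F)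
  have hφ : ∀ U : Set X, ∃ φ : X → ℝ, U ∈ 𝒰 → Continuous φ ∧ (∀ x, φ x = 0 ↔ x ∈ F U) ∧
      ∀ x, |φ x| < 1 → x ∈ U := fun U => by
    by_cases hU : U ∈ 𝒰
    · obtain ⟨φ, hφ⟩ := (hF U hU).1.exists_separating (hcoz U hU) (hF U hU).2
      exact ⟨φ, fun _ => hφ⟩
    · exact ⟨0, fun h => absurd h hU⟩
  choose φ hφ using hφ
  let e : ℕ ↪ t := htinf.natEmbedding
  have he : ∀ n, (e n : Set X) ∈ 𝒰 := fun n => htsub (e n).2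
  have hinj : Function.Injective fun n => φ (e n) := fun m n hmn => by
    refine e.injective (Subtype.ext (htbij.injOn (e m).2 (e n).2 ?_))
    ext x
    rw [← (hφ _ (he m)).2.1, ← (hφ _ (he n)).2.1]
    exact iff_of_eq (congrArg (fun f : X → ℝ => f x = 0) hmn)
  refine ⟨range fun n => φ (e n), ⟨countable_range _, ?_, ?_, infinite_range_of_injective hinj,
    forall_nhds_zero_finite_diff_iff.2 fun x ε hε => ?_⟩, ?_⟩
  · rintro _ ⟨n, rfl⟩
    exact (hφ _ (he n)).1
  · rintro ⟨n, hn⟩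
    refine huniv ((eq_univ_of_forall fun x => ?_) ▸ he n)
    refine (hφ _ (he n)).2.2 x ?_
    simp only at hn
    simp [hn]
  · have hfin : {n | x ∉ F (e n)}.Finite := by
      refine Finite.of_finite_image ((hFfin x).subset ?_) (f := fun n => F (e n)) ?_
      · rintro _ ⟨n, hn, rfl⟩
        exact ⟨mem_image_of_mem F (he n), hn⟩
      · intro m _ n _ hmn
        exact e.injective (Subtype.ext (htbij.injOn (e m).2 (e n).2 hmn))
    refine (hfin.image fun n => φ (e n)).subset ?_
    rintro _ ⟨⟨n, rfl⟩, hn⟩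
    refine ⟨n, fun hx => hn ?_, rfl⟩
    simpa [((hφ _ (he n)).2.1 x).2 hx] using hε
  · rintro _ ⟨n, rfl⟩
    exact ⟨e n, he n, (hφ _ (he n)).2.2⟩

/-- The sublevel sets of a set of functions converging to `0` form a `γ_F`-shrinkable cover,
provided that they contain no finite subcover. -/
theorem GammaZero.isGammaFCover {X : Type u} [TopologicalSpace X] {S : Set (X → ℝ)}
    (hS : GammaZero S) {c : ℝ} (hc : 0 < c)
    (hsub : ¬ HasFinSubcover ((fun f : X → ℝ => {x | |f x| < c}) '' S)) :
    IsGammaFCover ((fun f : X → ℝ => {x | |f x| < c}) '' S) := by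
  obtain ⟨-, hcont, -, hinf, hconv⟩ := hS
  rw [forall_nhds_zero_finite_diff_iff] at hconv
  set sub : (X → ℝ) → Set X := fun f => {x | |f x| < c} with hsubdef
  set 𝒰 := sub '' S
  have huniv : univ ∉ 𝒰 := fun h =>
    hsub ⟨{univ}, singleton_subset_iff.2 h, finite_singleton _, sUnion_singleton _⟩
  have hcover : ⋃₀ 𝒰 = univ := eq_univ_of_forall fun x => by
    obtain ⟨f, hf, hfx⟩ := (hinf.sdiff (hconv x c hc)).nonempty
    exact ⟨sub f, mem_image_of_mem _ hf, by_contra fun h => hfx ⟨hf, h⟩⟩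
  have h𝒰inf : 𝒰.Infinite := fun hfin => hsub ⟨𝒰, Subset.rfl, hfin, hcover⟩
  have hchoice : ∀ V : Set X, ∃ g : X → ℝ, V ∈ 𝒰 → g ∈ S ∧ sub g = V := fun V => by
    by_cases hV : V ∈ 𝒰
    · obtain ⟨g, hg⟩ := hV
      exact ⟨g, fun _ => hg⟩
    · exact ⟨0, fun h => absurd h hV⟩
  choose g hg using hchoice
  let F : Set X → Set X := fun V => {x | |g V x| ≤ c / 2}
  have hFV : ∀ V ∈ 𝒰, F V ⊆ V := fun V hV x hx => by
    rw [← (hg V hV).2]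
    exact lt_of_le_of_lt (mem_ofPred.1 hx) (half_lt_self hc)
  have hFfin : ∀ x, {V ∈ 𝒰 | x ∉ F V}.Finite := fun x => by
    refine ((hconv x (c / 2) (half_pos hc)).image sub).subset ?_
    rintro V ⟨hV, hx⟩
    exact ⟨g V, ⟨(hg V hV).1, fun h => hx h.le⟩, (hg V hV).2⟩
  have hFcover : ⋃₀ (F '' 𝒰) = univ := eq_univ_of_forall fun x => by
    obtain ⟨V, hV, hVx⟩ := (h𝒰inf.sdiff (hFfin x)).nonempty
    exact ⟨F V, mem_image_of_mem _ hV, by_contra fun h => hVx ⟨hV, h⟩⟩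
  refine ⟨⟨?_, huniv, h𝒰inf, hcover, fun x => ?_⟩, ?_, F, fun V hV => ⟨?_, hFV V hV⟩,
    ?_, ?_, hFcover, fun x => ?_⟩
  · rintro _ ⟨f, hf, rfl⟩
    exact isOpen_lt (hcont f hf).abs continuous_const
  · exact (hFfin x).subset fun V hV => ⟨hV.1, fun h => hV.2 (hFV V hV.1 h)⟩
  · rintro _ ⟨f, hf, rfl⟩
    have : (sub f)ᶜ = {x | c ≤ |f x|} := by
      ext x
      simp [hsubdef]
    rw [IsCozeroSet, this]
    exact isZeroSet_setOf_le continuous_const (hcont f hf).abs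
  · exact isZeroSet_setOf_le (hcont _ (hg V hV).1).abs continuous_const
  · rintro ⟨V, hV, hVuniv⟩
    exact huniv (univ_subset_iff.1 (hVuniv ▸ hFV V hV) ▸ hV)
  · intro hfin
    obtain ⟨t, ht, hbij⟩ := exists_subset_bijOn 𝒰 F
    refine hsub ⟨t, ht, Finite.of_finite_image (hbij.image_eq ▸ hfin) hbij.injOn,
      eq_univ_of_forall fun x => ?_⟩
    obtain ⟨W, hW, hxW⟩ := hFcover.symm ▸ mem_univ x
    obtain ⟨V, hV, rfl⟩ := hbij.surjOn hW
    exact ⟨V, hV, hFV V (ht hV) hxW⟩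
  · refine ((hFfin x).image F).subset ?_
    rintro _ ⟨⟨V, hV, rfl⟩, hx⟩
    exact ⟨V, ⟨hV, hx⟩, rfl⟩

/-- In a sequence of sets forming an `ω`-cover, every finite set is contained in terms of
arbitrarily large index. -/
theorem IsOmegaCover.exists_ge_subset {X : Type u} [TopologicalSpace X] {V : ℕ → Set X}
    (h : IsOmegaCover (range V)) {K : Set X} (hK : K.Finite) (m : ℕ) :
    ∃ n, m ≤ n ∧ K ⊆ V n := by
  obtain ⟨-, huniv, -, hfin⟩ := h
  have hne : ∀ n, ∃ x, x ∉ V n := fun n => by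
    by_contra! hn
    exact huniv ⟨n, eq_univ_of_forall hn⟩
  choose p hp using hne
  obtain ⟨_, ⟨n, rfl⟩, hn⟩ := hfin (K ∪ p '' Iio m) (hK.union ((finite_Iio m).image p))
  refine ⟨n, not_lt.1 fun hnm => hp n (hn (Or.inr (mem_image_of_mem p hnm))), ?_⟩
  exact subset_union_left.trans hn

theorem FfinGammaOmega.ufinGammaFOmega {X : Type u} [TopologicalSpace X]
    (h : FfinGammaOmega X) : UfinGammaFOmega X := by
  intro 𝒰 h𝒰 hsub
  choose S hS hSU using fun n => (h𝒰 n).exists_gammaZero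
  obtain ⟨F, hF, hFK⟩ := h S hS
  choose! U hU hUx using hSU
  have hmem : ∀ n, U n '' F n ⊆ 𝒰 n := fun n =>
    image_subset_iff.2 fun f hf => hU n f ((hF n).1 hf)
  have hω : ∀ K : Set X, K.Finite → ∃ n, K ⊆ ⋃₀ (U n '' F n) := fun K hK => by
    obtain ⟨n, hn⟩ := hFK 1 one_pos K hK
    refine ⟨n, fun x hx => ?_⟩
    obtain ⟨f, hf, hfx⟩ := hn x hx
    exact ⟨U n f, mem_image_of_mem _ hf, hUx n f ((hF n).1 hf) x hfx⟩
  refine ⟨fun n => U n '' F n, fun n => ⟨hmem n, (hF n).2.image _⟩, ?_, ?_, ?_, ?_⟩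
  · rintro _ ⟨n, rfl⟩
    exact isOpen_sUnion fun V hV => (h𝒰 n).1.1 V (hmem n hV)
  · rintro ⟨n, hn⟩
    exact hsub n ⟨_, hmem n, (hF n).2.image _, hn⟩
  · refine eq_univ_of_forall fun x => ?_
    obtain ⟨n, hn⟩ := hω {x} (finite_singleton x)
    exact ⟨_, mem_range_self n, hn rfl⟩
  · intro K hK
    obtain ⟨n, hn⟩ := hω K hK
    exact ⟨_, mem_range_self n, hn⟩

theorem UfinGammaFOmega.ffinGammaOmega {X : Type u} [TopologicalSpace X]
    (h : UfinGammaFOmega X) : FfinGammaOmega X := by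
  intro S hS
  let c : ℕ → ℝ := fun n => 1 / ((n : ℝ) + 1)
  have hc : ∀ n, 0 < c n := fun n => Nat.one_div_pos_of_nat
  let 𝒰 : ℕ → Set (Set X) := fun n => (fun f : X → ℝ => {x | |f x| < c n}) '' S n
  -- finite subfamilies of the covers `𝒰 n` give the required finite sets of functions
  suffices H : ∃ 𝓕 : ℕ → Set (Set X), (∀ n, 𝓕 n ⊆ 𝒰 n ∧ (𝓕 n).Finite) ∧
      ∀ K : Set X, K.Finite → ∀ m, ∃ n, m ≤ n ∧ K ⊆ ⋃₀ 𝓕 n by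
    obtain ⟨𝓕, h𝓕, hK𝓕⟩ := H
    have hlift : ∀ n, ∃ G ⊆ S n, G.Finite ∧
        (fun f : X → ℝ => {x | |f x| < c n}) '' G = 𝓕 n := fun n =>
      exists_subset_image_finite_and (p := fun t => t = 𝓕 n).1 ⟨𝓕 n, (h𝓕 n).1, (h𝓕 n).2, rfl⟩
    choose G hGS hGfin hG using hlift
    refine ⟨G, fun n => ⟨hGS n, hGfin n⟩, fun ε hε K hK => ?_⟩
    obtain ⟨m, hm⟩ := exists_nat_one_div_lt hε
    obtain ⟨n, hmn, hn⟩ := hK𝓕 K hK m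
    refine ⟨n, fun x hx => ?_⟩
    obtain ⟨V, hV, hxV⟩ := hn hx
    rw [← hG n] at hV
    obtain ⟨f, hf, rfl⟩ := hV
    exact ⟨f, hf, hxV.trans ((Nat.one_div_le_one_div hmn).trans_lt hm)⟩
  by_cases hbad : ∃ N, ∀ n, N ≤ n → ¬ HasFinSubcover (𝒰 n)
  · obtain ⟨N, hN⟩ := hbad
    obtain ⟨𝓕, h𝓕, hω⟩ := h (fun n => 𝒰 (n + N))
      (fun n => (hS _).isGammaFCover (hc _) (hN _ (Nat.le_add_left N n)))
      (fun n => hN _ (Nat.le_add_left N n))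
    refine ⟨fun n => if N ≤ n then 𝓕 (n - N) else ∅, fun n => ?_, fun K hK m => ?_⟩
    · by_cases hn : N ≤ n
      · have := h𝓕 (n - N)
        simp only [Nat.sub_add_cancel hn] at this
        simpa only [if_pos hn] using this
      · simp [hn]
    · obtain ⟨n, hmn, hn⟩ := hω.exists_ge_subset hK m
      exact ⟨n + N, by omega, by simpa using hn⟩
  · push Not at hbad
    choose! 𝓕 h𝓕 using fun n (hn : HasFinSubcover (𝒰 n)) => hn
    classical
    refine ⟨fun n => if HasFinSubcover (𝒰 n) then 𝓕 n else ∅, fun n => ?_, fun K _ m => ?_⟩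
    · by_cases hn : HasFinSubcover (𝒰 n)
      · simpa only [if_pos hn] using ⟨(h𝓕 n hn).1, (h𝓕 n hn).2.1⟩
      · simp [hn]
    · obtain ⟨n, hmn, hn⟩ := hbad m
      refine ⟨n, hmn, ?_⟩
      simp only [if_pos hn, (h𝓕 n hn).2.2, subset_univ]

/-- Theorem 3.1: for a Tychonoff space `X`, `C_p(X)` satisfies `F_fin(Γ_0, Ω_0)`
iff `X` satisfies `U_fin(Γ_F, Ω)`. -/
theorem stmt0 (X : Type u) [TopologicalSpace X] [CompletelyRegularSpace X] [T2Space X] :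
    FfinGammaOmega X ↔ UfinGammaFOmega X := by
  exact ⟨FfinGammaOmega.ufinGammaFOmega, UfinGammaFOmega.ffinGammaOmega⟩
end

section
/- Let 𝒰 = {U_n : n ∈ ℕ} be a countable γ_F-shrinkable cozero γ-cover of a Tychonoff space X. Then the set S = {f ∈ C(X) : f is identically 1 on X ∖ U_n for some n ∈ ℕ} is sequentially dense in C_p(X). -/
open Set Filter Topology

universe u

/-- Disjoint zero-sets are separated by a continuous real-valued function. -/
lemma IsZeroSet.exists_continuous_zero_one {X : Type u} [TopologicalSpace X] {A B : Set X}
    (hA : IsZeroSet A) (hB : IsZeroSet B) (hAB : Disjoint A B) :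
    ∃ h : X → ℝ, Continuous h ∧ (∀ x ∈ A, h x = 0) ∧ ∀ x ∈ B, h x = 1 := by
  obtain ⟨a, ha, rfl⟩ := hA
  obtain ⟨b, hb, rfl⟩ := hB
  have hne (x : X) : |a x| + |b x| ≠ 0 := fun hx => by
    have hax : a x = 0 := abs_eq_zero.1 (by linarith [abs_nonneg (a x), abs_nonneg (b x)])
    have hbx : b x = 0 := abs_eq_zero.1 (by linarith [abs_nonneg (a x), abs_nonneg (b x)])
    exact disjoint_left.1 hAB hax hbx
  refine ⟨fun x => |a x| / (|a x| + |b x|), ha.abs.div (ha.abs.add hb.abs) hne,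
    fun x hx => ?_, fun x hx => ?_⟩
  · have hax : a x = 0 := hx
    simp [hax]
  · have hbx : b x = 0 := hx
    have := hne x
    simp_all

/-- Lemma 3.2: if `{U n : n ∈ ℕ}` is a γ_F-shrinkable cozero γ-cover of a Tychonoff
space `X`, then `{f ∈ C(X) : f ≡ 1 on X \ U n for some n}` is sequentially dense
in `C_p(X)`. -/
theorem stmt1 (X : Type u) [TopologicalSpace X] [CompletelyRegularSpace X] [T2Space X]
    (U : ℕ → Set X) (hU : IsGammaFCover (Set.range U)) :
    SeqDenseCp {f : X → ℝ | Continuous f ∧ ∃ n : ℕ, ∀ x ∈ (U n)ᶜ, f x = 1} := by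
  obtain ⟨-, hcoz, F, hF, -, hinf, -, hfin⟩ := hU
  refine ⟨fun f hf => hf.1, fun f hf => ?_⟩
  have hV (k : ℕ) : ∃ n, F (U n) = hinf.natEmbedding _ k := by
    obtain ⟨_, ⟨n, rfl⟩, hn⟩ := (hinf.natEmbedding _ k).2
    exact ⟨n, hn⟩
  choose n hn using hV
  have hsep (k : ℕ) := (hF _ (mem_range_self (n k))).1.exists_continuous_zero_one
    (hcoz _ (mem_range_self (n k))) (disjoint_compl_right_iff_subset.2
      (hF _ (mem_range_self (n k))).2)
  choose h hcont h0 h1 using hsep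
  refine ⟨fun k x => f x * (1 - h k x) + h k x, fun k => ⟨?_, n k, fun x hx => ?_⟩, ?_⟩
  · have := hcont k
    fun_prop
  · simp [h1 k x hx]
  · refine tendsto_pi_nhds.2 fun x => tendsto_const_nhds.congr' ?_
    have hx : {k : ℕ | x ∉ F (U (n k))}.Finite := by
      refine Finite.of_finite_image ((hfin x).subset ?_)
        (f := fun k => (hinf.natEmbedding _ k : Set X))
        (Subtype.val_injective.comp (hinf.natEmbedding _).injective).injOn
      rintro _ ⟨k, hk, rfl⟩
      exact ⟨(hinf.natEmbedding _ k).2, by simpa only [mem_ofPred_eq, hn] using hk⟩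
    rw [← Nat.cofinite_eq_atTop]
    filter_upwards [hx.compl_mem_cofinite] with k hk
    simp [h0 k x (not_not.1 hk)]
end

section
/- For a separable metrizable space X, the following are equivalent: (1) C_p(X) satisfies F_fin(𝒮, 𝒟); (2) X satisfies U_fin(𝒪, Ω); (3) C_p(X) satisfies F_fin(Γ_0, Ω_0); (4) C_p(X) satisfies F_fin(𝒮, Ω_0). -/
open Set Filter Topology

universe u

section

variable {X : Type u} [TopologicalSpace X]

/-- Under `U_fin(𝒪, Ω)`, from increasing countable open covers one can pick one member each
so that every finite set is contained in arbitrarily late picks. -/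
theorem UfinOOmega.exists_frequently_subset (hX : UfinOOmega X) (V : ℕ → ℕ → Set X)
    (hopen : ∀ n k, IsOpen (V n k)) (hmono : ∀ n, Monotone (V n))
    (hcover : ∀ n x, ∃ k, x ∈ V n k) :
    ∃ k : ℕ → ℕ, ∀ K : Set X, K.Finite → ∀ N, ∃ n ≥ N, K ⊆ V n (k n) := by
  have hfin : ∀ n, ∀ 𝓕 ⊆ range (V n), 𝓕.Finite → ∃ k, ⋃₀ 𝓕 ⊆ V n k := by
    intro n 𝓕 hsub h𝓕
    choose! g hg using hsub
    obtain ⟨k, hk⟩ := (h𝓕.image g).bddAbove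
    exact ⟨k, sUnion_subset fun U hU => hg hU ▸ hmono n (hk ⟨U, hU, rfl⟩)⟩
  have hsUnion : ∀ n, ⋃₀ range (V n) = univ := fun n =>
    eq_univ_of_forall fun x => let ⟨k, hk⟩ := hcover n x; ⟨_, ⟨k, rfl⟩, hk⟩
  by_cases hinf : ∃ᶠ n in atTop, HasFinSubcover (range (V n))
  · have huniv : ∀ n, ∃ k, HasFinSubcover (range (V n)) → V n k = univ := by
      intro n
      by_cases h : HasFinSubcover (range (V n))
      · obtain ⟨𝓕, hsub, h𝓕, hU⟩ := h
        obtain ⟨k, hk⟩ := hfin n 𝓕 hsub h𝓕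
        exact ⟨k, fun _ => univ_subset_iff.1 (hU ▸ hk)⟩
      · exact ⟨0, fun h' => absurd h' h⟩
    choose k hk using huniv
    refine ⟨k, fun K _ N => ?_⟩
    obtain ⟨n, hn, h⟩ := frequently_atTop.1 hinf N
    exact ⟨n, hn, by simp [hk n h]⟩
  · obtain ⟨N₀, hN₀⟩ := eventually_atTop.1 (not_frequently.1 hinf)
    obtain ⟨𝓕, h𝓕, -, hne, -, hω⟩ := hX (fun n => range (V (n + N₀)))
      (fun n => ⟨by rintro _ ⟨k, rfl⟩; exact hopen _ _, hsUnion _⟩)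
      (fun n => hN₀ _ (Nat.le_add_left _ _))
    have hout : ∀ n, ∃ x, x ∉ ⋃₀ 𝓕 n := fun n =>
      (ne_univ_iff_exists_notMem _).1 fun h => hne ⟨n, h⟩
    choose p hp using hout
    choose k hk using fun n => hfin (n + N₀) (𝓕 n) (h𝓕 n).1 (h𝓕 n).2
    refine ⟨fun n => k (n - N₀), fun K hK N => ?_⟩
    obtain ⟨_, ⟨n, rfl⟩, hn⟩ := hω (K ∪ p '' Iio N) (hK.union ((finite_Iio N).image p))
    refine ⟨n + N₀, ?_, ?_⟩
    · by_contra! hlt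
      exact hp n (hn (Or.inr ⟨n, by simp only [mem_Iio]; omega, rfl⟩))
    · simpa using (subset_union_left.trans hn).trans (hk n)

theorem isOpen_setOf_exists_le_abs_sub_lt {h : ℕ → X → ℝ} (hh : ∀ j, Continuous (h j))
    (q ε : ℝ) (k : ℕ) : IsOpen {x | ∃ j ≤ k, |h j x - q| < ε} := by
  have : {x | ∃ j ≤ k, |h j x - q| < ε} = ⋃ j ∈ Iic k, {x | |h j x - q| < ε} := by
    ext x; simp
  rw [this]
  exact isOpen_biUnion fun j _ => isOpen_lt (((hh j).sub continuous_const).abs) continuous_const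

theorem UfinOOmega.ffinSD (hX : UfinOOmega X) : FfinSD X := by
  intro S hS
  let q : ℕ → ℝ := TopologicalSpace.denseSeq ℝ
  choose h hmem hlim using fun n i => (hS n).2 (fun _ => q i) continuous_const
  obtain ⟨k, hk⟩ := hX.exists_frequently_subset
    (fun n k => {x | ∀ i ∈ Iic n, ∃ j ≤ k, |h n i j x - q i| < 1 / ((n : ℝ) + 1)})
    (fun n k => by
      simp only [ofPred_forall]
      exact (finite_Iic n).isOpen_biInter fun i _ =>
        isOpen_setOf_exists_le_abs_sub_lt (fun j => (hS n).1 _ (hmem n i j)) _ _ _)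
    (fun n a b hab x hx i hi => let ⟨j, hj, hlt⟩ := hx i hi; ⟨j, hj.trans hab, hlt⟩)
    (fun n x => by
      have hev : ∀ᶠ k in atTop, ∀ i ∈ Iic n, |h n i k x - q i| < 1 / ((n : ℝ) + 1) := by
        rw [eventually_all_finite (finite_Iic n)]
        intro i _
        exact Metric.tendsto_nhds.1 (tendsto_pi_nhds.1 (hlim n i) x) _ (by positivity)
      obtain ⟨k, hk⟩ := hev.exists
      exact ⟨k, fun i hi => ⟨k, le_rfl, hk i hi⟩⟩)
  refine ⟨fun n => image2 (h n) (Iic n) (Iic (k n)), fun n => ⟨?_, ?_⟩, ?_⟩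
  · rintro _ ⟨i, -, j, -, rfl⟩
    exact hmem n i j
  · exact (finite_Iic n).image2 _ (finite_Iic (k n))
  · intro f _ ε hε K hK
    have happrox : ∀ x, ∃ i, |f x - q i| < ε / 2 := fun x =>
      (TopologicalSpace.denseRange_denseSeq ℝ).exists_dist_lt (f x) (half_pos hε)
    choose i hi using happrox
    obtain ⟨N₁, hN₁⟩ := (hK.image i).bddAbove
    obtain ⟨N₂, hN₂⟩ := exists_nat_one_div_lt (half_pos hε)
    obtain ⟨n, hn, hsub⟩ := hk K hK (max N₁ N₂)
    refine ⟨n, fun x hx => ?_⟩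
    have hin : i x ≤ n := (hN₁ ⟨x, hx, rfl⟩).trans ((le_max_left _ _).trans hn)
    obtain ⟨j, hj, hlt⟩ := hsub hx (i x) hin
    refine ⟨_, ⟨i x, hin, j, hj, rfl⟩, ?_⟩
    have hNn : 1 / ((n : ℝ) + 1) ≤ 1 / ((N₂ : ℝ) + 1) :=
      Nat.one_div_le_one_div ((le_max_right _ _).trans hn)
    have htri := abs_sub_le (f x) (q (i x)) (h n (i x) j x)
    rw [abs_sub_comm (q (i x))] at htri
    linarith [hi x]

theorem FfinSD.ffinSOmega (hX : FfinSD X) : FfinSOmega X := by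
  intro S hS
  obtain ⟨F, hF, h⟩ := hX S hS
  refine ⟨F, hF, fun ε hε K hK => ?_⟩
  simpa using h 0 continuous_zero ε hε K hK

theorem UfinOOmega.ffinGammaOmega (hX : UfinOOmega X) : FfinGammaOmega X := by
  intro S hS
  choose h hrange using fun n => (hS n).1.exists_eq_range (hS n).2.2.2.1.nonempty
  have hmem : ∀ n j, h n j ∈ S n := fun n j => hrange n ▸ mem_range_self j
  obtain ⟨k, hk⟩ := hX.exists_frequently_subset
    (fun n k => {x | ∃ j ≤ k, |h n j x - 0| < 1 / ((n : ℝ) + 1)})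
    (fun n k => isOpen_setOf_exists_le_abs_sub_lt (fun j => (hS n).2.1 _ (hmem n j)) _ _ _)
    (fun n a b hab x ⟨j, hj, hlt⟩ => ⟨j, hj.trans hab, hlt⟩)
    (fun n x => by
      have hU : {f : X → ℝ | |f x - 0| < 1 / ((n : ℝ) + 1)} ∈ 𝓝 (0 : X → ℝ) :=
        (isOpen_lt (((continuous_apply x).sub continuous_const).abs) continuous_const).mem_nhds
          (by
            change |(0 : ℝ) - 0| < _
            rw [sub_zero, abs_zero]
            positivity)
      obtain ⟨f, hf, hfU⟩ := (hS n).2.2.2.1.exists_notMem_finite ((hS n).2.2.2.2 _ hU)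
      rw [hrange n] at hf
      obtain ⟨j, rfl⟩ := hf
      exact ⟨j, j, le_rfl, by_contra fun hj => hfU ⟨hmem n j, hj⟩⟩)
  refine ⟨fun n => h n '' Iic (k n), fun n => ⟨?_, (finite_Iic _).image _⟩, ?_⟩
  · rintro _ ⟨j, -, rfl⟩
    exact hmem n j
  · intro ε hε K hK
    obtain ⟨N, hN⟩ := exists_nat_one_div_lt hε
    obtain ⟨n, hn, hsub⟩ := hk K hK N
    refine ⟨n, fun x hx => ?_⟩
    obtain ⟨j, hj, hlt⟩ := hsub hx
    rw [sub_zero] at hlt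
    exact ⟨_, ⟨j, hj, rfl⟩, hlt.trans_le ((Nat.one_div_le_one_div hn).trans hN.le)⟩

theorem nonempty_of_not_hasFinSubcover {X : Type u} {𝒰 : Set (Set X)} (h : ¬ HasFinSubcover 𝒰) :
    Nonempty X := by
  by_contra hX
  rw [not_nonempty_iff] at hX
  exact h ⟨∅, empty_subset _, finite_empty, Subsingleton.elim _ _⟩

/-- An open cover without finite subcover of a separable metrizable space yields a sequence of
positive continuous functions converging to `0`, each equal to `1` off a finite subfamily. -/
theorem exists_tendsto_zero_eq_one_off_finite [TopologicalSpace.MetrizableSpace X]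
    [TopologicalSpace.SeparableSpace X] {𝒰 : Set (Set X)} (hopen : ∀ U ∈ 𝒰, IsOpen U)
    (hcover : ⋃₀ 𝒰 = univ) (hfin : ¬ HasFinSubcover 𝒰) :
    ∃ φ : ℕ → X → ℝ, (∀ k, Continuous (φ k)) ∧ (∀ k x, 0 < φ k x) ∧
      Tendsto φ atTop (𝓝 0) ∧
      ∀ k, ∃ 𝓕 ⊆ 𝒰, 𝓕.Finite ∧ ∀ x ∉ ⋃₀ 𝓕, φ k x = 1 := by
  let := TopologicalSpace.metrizableSpaceMetric X
  have := UniformSpace.secondCountable_of_separable X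
  have := nonempty_of_not_hasFinSubcover hfin
  obtain ⟨T, hTc, hTsub, hT⟩ := TopologicalSpace.isOpen_sUnion_countable 𝒰 hopen
  rw [hcover] at hT
  have hTne : T.Nonempty := by
    obtain ⟨U, hU, -⟩ := (hT ▸ mem_univ (Classical.arbitrary X) : Classical.arbitrary X ∈ ⋃₀ T)
    exact ⟨U, hU⟩
  obtain ⟨U, rfl⟩ := hTc.exists_eq_range hTne
  have hU : ∀ i, U i ∈ 𝒰 := fun i => hTsub ⟨i, rfl⟩
  let s : ℕ → X → ℝ := fun k x => ∑ i ∈ Finset.range (k + 1), Metric.infDist x (U i)ᶜ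
  have hs : Monotone s := by
    intro a b hab x
    exact Finset.sum_le_sum_of_subset_of_nonneg
      (Finset.range_mono (by omega)) fun _ _ _ => Metric.infDist_nonneg
  refine ⟨fun k x => Real.exp (-(k * s k x)), fun k => ?_, fun k x => Real.exp_pos _, ?_, ?_⟩
  · exact Real.continuous_exp.comp (continuous_const.mul
      (continuous_finsetSum _ fun i _ => Metric.continuous_infDist_pt _)).neg
  · rw [tendsto_pi_nhds]
    intro x
    obtain ⟨_, ⟨i, rfl⟩, hx⟩ := (hT ▸ mem_univ x : x ∈ ⋃₀ range U)
    have hne : (U i)ᶜ.Nonempty := by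
      rw [nonempty_compl]
      intro h
      exact hfin ⟨{U i}, by simpa using hU i, finite_singleton _, by simpa using h⟩
    have hpos : 0 < Metric.infDist x (U i)ᶜ :=
      ((hopen _ (hU i)).isClosed_compl.notMem_iff_infDist_pos hne).1 (by simpa using hx)
    have hsi : Metric.infDist x (U i)ᶜ ≤ s i x :=
      Finset.single_le_sum (f := fun i => Metric.infDist x (U i)ᶜ)
        (fun _ _ => Metric.infDist_nonneg) (Finset.self_mem_range_succ i)
    refine Real.tendsto_exp_neg_atTop_nhds_zero.comp ?_
    refine tendsto_atTop_mono' _ ?_ (tendsto_natCast_atTop_atTop.atTop_mul_const hpos)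
    filter_upwards [eventually_ge_atTop i] with k hk
    exact mul_le_mul_of_nonneg_left (hsi.trans (hs hk x)) k.cast_nonneg
  · intro k
    refine ⟨U '' Iic k, ?_, (finite_Iic k).image U, fun x hx => ?_⟩
    · rintro _ ⟨i, -, rfl⟩
      exact hU i
    · have hzero : s k x = 0 := Finset.sum_eq_zero fun i hi =>
        Metric.infDist_zero_of_mem fun hxi =>
          hx ⟨U i, ⟨i, Finset.mem_range_succ_iff.1 hi, rfl⟩, hxi⟩
      simp [hzero]

/-- Finite selections of continuous functions, each of absolute value at least `1` off a finite
subfamily of the corresponding cover, induce a selection witnessing `U_fin(𝒪, Ω)`. -/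
theorem exists_isOmegaCover_of_functions {𝒰 : ℕ → Set (Set X)}
    (hopen : ∀ n, ∀ U ∈ 𝒰 n, IsOpen U) (hfin : ∀ n, ¬ HasFinSubcover (𝒰 n))
    {F : ℕ → Set (X → ℝ)} (hF : ∀ n, (F n).Finite)
    (hoff : ∀ n, ∀ h ∈ F n, ∃ 𝓕 ⊆ 𝒰 n, 𝓕.Finite ∧ ∀ x ∉ ⋃₀ 𝓕, h x = 1)
    (hsel : ∀ ε : ℝ, 0 < ε → ∀ K : Set X, K.Finite →
        ∃ n : ℕ, ∀ x ∈ K, ∃ h ∈ F n, |h x| < ε) :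
    ∃ 𝓕 : ℕ → Set (Set X), (∀ n, 𝓕 n ⊆ 𝒰 n ∧ (𝓕 n).Finite) ∧
      IsOmegaCover (Set.range fun n => ⋃₀ 𝓕 n) := by
  choose! G hGsub hGfin hG using hoff
  have hsub : ∀ n, (⋃ h ∈ F n, G n h) ⊆ 𝒰 n := fun n => iUnion₂_subset (hGsub n)
  have hfinite : ∀ n, (⋃ h ∈ F n, G n h).Finite := fun n => (hF n).biUnion (hGfin n)
  have hω : ∀ K : Set X, K.Finite → ∃ n, K ⊆ ⋃₀ ⋃ h ∈ F n, G n h := by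
    intro K hK
    obtain ⟨n, hn⟩ := hsel 1 one_pos K hK
    refine ⟨n, fun x hx => ?_⟩
    obtain ⟨h, hh, hlt⟩ := hn x hx
    have hxG : x ∈ ⋃₀ G n h := by
      by_contra hx'
      simp [hG n h hh x hx'] at hlt
    exact sUnion_mono (subset_biUnion_of_mem (u := G n) hh) hxG
  refine ⟨fun n => ⋃ h ∈ F n, G n h, fun n => ⟨hsub n, hfinite n⟩, ?_, ?_, ?_, ?_⟩
  · rintro _ ⟨n, rfl⟩
    exact isOpen_sUnion fun U hU => hopen n U (hsub n hU)
  · rintro ⟨n, hn⟩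
    exact hfin n ⟨_, hsub n, hfinite n, hn⟩
  · refine eq_univ_of_forall fun x => ?_
    obtain ⟨n, hn⟩ := hω {x} (finite_singleton x)
    exact ⟨_, ⟨n, rfl⟩, hn rfl⟩
  · intro K hK
    obtain ⟨n, hn⟩ := hω K hK
    exact ⟨_, ⟨n, rfl⟩, hn⟩

theorem FfinGammaOmega.ufinOOmega [TopologicalSpace.MetrizableSpace X]
    [TopologicalSpace.SeparableSpace X] (hX : FfinGammaOmega X) : UfinOOmega X := by
  intro 𝒰 h𝒰 hfin
  have := nonempty_of_not_hasFinSubcover (hfin 0)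
  choose φ hcont hpos hlim hone using fun n =>
    exists_tendsto_zero_eq_one_off_finite (h𝒰 n).1 (h𝒰 n).2 (hfin n)
  have hzero : ∀ n, (0 : X → ℝ) ∉ range (φ n) := by
    rintro n ⟨k, hk⟩
    exact (hpos n k (Classical.arbitrary X)).ne' (congrFun hk _)
  obtain ⟨F, hF, hsel⟩ := hX (fun n => range (φ n)) fun n => by
    refine ⟨countable_range _, by rintro _ ⟨k, rfl⟩; exact hcont n k, hzero n, fun hfinite => ?_, ?_⟩
    · exact hzero n (hfinite.isClosed.mem_of_tendsto (hlim n) (.of_forall mem_range_self))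
    · intro U hU
      obtain ⟨N, hN⟩ := eventually_atTop.1 ((hlim n).eventually_mem hU)
      refine ((finite_Iio N).image (φ n)).subset ?_
      rintro _ ⟨⟨k, rfl⟩, hk⟩
      exact ⟨k, lt_of_not_ge fun h => hk (hN k h), rfl⟩
  refine exists_isOmegaCover_of_functions (fun n => (h𝒰 n).1) hfin (fun n => (hF n).2) ?_ hsel
  intro n h hh
  obtain ⟨k, rfl⟩ := (hF n).1 hh
  exact hone n k

theorem FfinSOmega.ufinOOmega [TopologicalSpace.MetrizableSpace X]
    [TopologicalSpace.SeparableSpace X] (hX : FfinSOmega X) : UfinOOmega X := by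
  intro 𝒰 h𝒰 hfin
  obtain ⟨F, hF, hsel⟩ := hX
    (fun n => {h | Continuous h ∧ ∃ 𝓕 ⊆ 𝒰 n, 𝓕.Finite ∧ ∀ x ∉ ⋃₀ 𝓕, h x = 1})
    fun n => by
      refine ⟨fun h hh => hh.1, fun f hf => ?_⟩
      obtain ⟨φ, hcont, -, hlim, hone⟩ :=
        exists_tendsto_zero_eq_one_off_finite (h𝒰 n).1 (h𝒰 n).2 (hfin n)
      refine ⟨fun k => (1 - φ k) * f + φ k, fun k => ⟨?_, ?_⟩, ?_⟩
      · exact ((continuous_const.sub (hcont k)).mul hf).add (hcont k)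
      · obtain ⟨𝓕, hsub, h𝓕, h1⟩ := hone k
        exact ⟨𝓕, hsub, h𝓕, fun x hx => by simp [h1 x hx]⟩
      · simpa using (((tendsto_const_nhds (x := (1 : X → ℝ))).sub hlim).mul_const f).add hlim
  exact exists_isOmegaCover_of_functions (fun n => (h𝒰 n).1) hfin (fun n => (hF n).2)
    (fun n h hh => ((hF n).1 hh).2) hsel

end

/-- Theorem 3.5: for a separable metrizable space `X`, the following are equivalent:
(1) `C_p(X) ⊨ F_fin(𝒮, 𝒟)`; (2) `X ⊨ U_fin(𝒪, Ω)`; (3) `C_p(X) ⊨ F_fin(Γ_0, Ω_0)`;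
(4) `C_p(X) ⊨ F_fin(𝒮, Ω_0)`. -/
theorem stmt4 (X : Type u) [TopologicalSpace X] [TopologicalSpace.MetrizableSpace X]
    [TopologicalSpace.SeparableSpace X] :
    [FfinSD X, UfinOOmega X, FfinGammaOmega X, FfinSOmega X].TFAE := by
  tfae_have 1 → 4 := FfinSD.ffinSOmega
  tfae_have 2 → 1 := UfinOOmega.ffinSD
  tfae_have 2 → 3 := UfinOOmega.ffinGammaOmega
  tfae_have 3 → 2 := FfinGammaOmega.ufinOOmega
  tfae_have 4 → 2 := FfinSOmega.ufinOOmega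
  tfae_finish
end

section
/- For a Tychonoff space X, the following are equivalent: (1) X is Lindelöf and satisfies U_fin(Γ_F, Γ); (2) X has the Hurewicz property. -/
open Set Filter Topology

universe u

/-- In a completely regular Lindelöf space every open cover admits a continuous nonnegative
function whose strict sublevel sets are each covered by finitely many members. -/
theorem exists_continuous_sublevel_subset_sUnion {X : Type u} [TopologicalSpace X]
    [CompletelyRegularSpace X] [LindelofSpace X] {𝒰 : Set (Set X)}
    (hopen : ∀ U ∈ 𝒰, IsOpen U) (hcov : ⋃₀ 𝒰 = (univ : Set X)) :
    ∃ h : X → ℝ, Continuous h ∧ (∀ x, 0 ≤ h x) ∧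
      ∀ K : ℝ, ∃ 𝓕 ⊆ 𝒰, 𝓕.Finite ∧ {x | h x < K} ⊆ ⋃₀ 𝓕 := by
  rcases isEmpty_or_nonempty X with hX | hX
  · exact ⟨fun _ => 0, continuous_const, fun _ => le_rfl, fun K =>
      ⟨∅, empty_subset _, finite_empty, fun x => isEmptyElim x⟩⟩
  have key : ∀ x : X, ∃ U ∈ 𝒰, ∃ g : X → ℝ, Continuous g ∧ (∀ y, 0 ≤ g y ∧ g y ≤ 1) ∧
      0 < g x ∧ ∀ y, 0 < g y → y ∈ U := by
    intro x
    obtain ⟨U, hU, hxU⟩ : x ∈ ⋃₀ 𝒰 := hcov ▸ mem_univ x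
    obtain ⟨f, hf, hfx, hfU⟩ := CompletelyRegularSpace.completely_regular x Uᶜ
      (hopen U hU).isClosed_compl (fun h => h hxU)
    refine ⟨U, hU, fun y => 1 - (f y : ℝ), by fun_prop, fun y => ⟨?_, ?_⟩, by simp [hfx], ?_⟩
    · linarith [(f y).2.2]
    · linarith [(f y).2.1]
    · intro y hy
      by_contra hyU
      have := hfU hyU
      simp [this] at hy
  choose U hU g hgc hg hgx hgU using key
  obtain ⟨t, htc, ht⟩ := LindelofSpace.elim_nhds_subcover (fun x => {y | 0 < g x y})
    (fun x => (isOpen_lt continuous_const (hgc x)).mem_nhds (hgx x))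
  have htne : t.Nonempty := by
    obtain ⟨x⟩ := hX
    have : x ∈ ⋃ x ∈ t, {y | 0 < g x y} := ht ▸ mem_univ x
    simp only [mem_iUnion] at this
    obtain ⟨i, hi, -⟩ := this
    exact ⟨i, hi⟩
  obtain ⟨e, rfl⟩ := htc.exists_eq_range htne
  have hgeo : Summable fun j : ℕ => (1 / 2 : ℝ) ^ j := summable_geometric_two
  have hle : ∀ j y, (1 / 2 : ℝ) ^ j * g (e j) y ≤ (1 / 2) ^ j := fun j y =>
    mul_le_of_le_one_right (by positivity) (hg _ y).2
  have hnn : ∀ j y, 0 ≤ (1 / 2 : ℝ) ^ j * g (e j) y := fun j y =>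
    mul_nonneg (by positivity) (hg _ y).1
  have hsum : ∀ y, Summable fun j : ℕ => (1 / 2 : ℝ) ^ j * g (e j) y := fun y =>
    hgeo.of_nonneg_of_le (hnn · y) (hle · y)
  set G : X → ℝ := fun y => ∑' j : ℕ, (1 / 2 : ℝ) ^ j * g (e j) y with hG
  have hGc : Continuous G := by
    refine continuous_tsum (fun j => (hgc (e j)).const_mul _) hgeo (fun j y => ?_)
    rw [Real.norm_of_nonneg (hnn j y)]
    exact hle j y
  have hGpos : ∀ y, 0 < G y := by
    intro y
    have : y ∈ ⋃ x ∈ range e, {y | 0 < g x y} := ht ▸ mem_univ y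
    simp only [mem_iUnion, mem_range, exists_prop, exists_exists_eq_and] at this
    obtain ⟨j, hj⟩ := this
    exact (hsum y).tsum_pos (hnn · y) j (mul_pos (by positivity) hj)
  refine ⟨fun y => (G y)⁻¹, hGc.inv₀ fun y => (hGpos y).ne', fun y => (inv_pos.2 (hGpos y)).le,
    fun K => ?_⟩
  obtain ⟨N, hN⟩ := exists_pow_lt_of_lt_one (show (0 : ℝ) < (2 * max K 1)⁻¹ by positivity)
    (show (1 / 2 : ℝ) < 1 by norm_num)
  refine ⟨(fun j => U (e j)) '' Iio N, ?_, (finite_Iio N).image _, fun y hy => ?_⟩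
  · rintro _ ⟨j, -, rfl⟩
    exact hU _
  by_contra hcon
  have hzero : ∀ j < N, g (e j) y = 0 := by
    intro j hj
    by_contra hne
    exact hcon ⟨_, ⟨j, hj, rfl⟩, hgU _ y (lt_of_le_of_ne (hg _ y).1 (Ne.symm hne))⟩
  have hGle : G y ≤ (1 / 2) ^ N * 2 := by
    have h0 : ∑ j ∈ Finset.range N, (1 / 2 : ℝ) ^ j * g (e j) y = 0 :=
      Finset.sum_eq_zero fun j hj => by rw [hzero j (Finset.mem_range.1 hj), mul_zero]
    have h1 := (hsum y).sum_add_tsum_nat_add N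
    rw [h0, zero_add] at h1
    refine h1.ge.trans <| (Summable.tsum_le_tsum (fun j => ?_)
      ((summable_nat_add_iff N).2 (hsum y)) (hgeo.mul_left ((1 / 2) ^ N))).trans_eq
      (by rw [tsum_mul_left, tsum_geometric_two])
    rw [← pow_add, add_comm N j]
    exact hle (j + N) y
  have hlt : G y < (max K 1)⁻¹ := by
    rw [mul_inv] at hN
    linarith
  have h2 : max K 1 < (G y)⁻¹ := (lt_inv_comm₀ (hGpos y) (by positivity)).1 hlt
  have h3 : (G y)⁻¹ < K := hy
  exact absurd (le_max_left K 1) (by linarith)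

/-- If every point lies in all but finitely many of the proper subsets `V i`, `i ∈ S`, with `S`
infinite, then these subsets are infinitely many. -/
theorem infinite_image_of_ne_univ {ι : Type*} {X : Type u} {V : ι → Set X} {S : Set ι}
    (hS : S.Infinite) (hV : ∀ i ∈ S, V i ≠ univ) (hfin : ∀ x, {i ∈ S | x ∉ V i}.Finite) :
    (V '' S).Infinite := by
  intro hcon
  obtain ⟨W, ⟨i, hi, rfl⟩, hW⟩ : ∃ W ∈ V '' S, {i ∈ S | V i = W}.Infinite := by
    by_contra! hno
    refine hS ((hcon.biUnion fun W hW => hno W hW).subset fun i hi => ?_)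
    exact mem_biUnion (mem_image_of_mem V hi) ⟨hi, rfl⟩
  obtain ⟨x, hx⟩ := (ne_univ_iff_exists_notMem _).1 (hV i hi)
  exact hW ((hfin x).subset fun j hj => ⟨hj.1, hj.2 ▸ hx⟩)

theorem isGammaCoverSets_image {ι : Type*} {X : Type u} {V : ι → Set X} {S : Set ι}
    (hS : S.Infinite) (hV : ∀ i ∈ S, V i ≠ univ) (hfin : ∀ x, {i ∈ S | x ∉ V i}.Finite) :
    IsGammaCoverSets (V '' S) := by
  refine ⟨?_, infinite_image_of_ne_univ hS hV hfin, ?_, fun x => ?_⟩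
  · rintro ⟨i, hi, h⟩
    exact hV i hi h
  · refine eq_univ_of_forall fun x => ?_
    obtain ⟨i, hi, hx⟩ := (hS.sdiff (hfin x)).nonempty
    exact ⟨V i, mem_image_of_mem V hi, by_contra fun h => hx ⟨hi, h⟩⟩
  · refine ((hfin x).image V).subset ?_
    rintro _ ⟨⟨i, hi, rfl⟩, hx⟩
    exact ⟨i, ⟨hi, hx⟩, rfl⟩

/-- The strict sublevel sets of an unbounded continuous function at natural heights form a
`γ_F`-shrinkable `γ`-cover. -/
theorem isGammaFCover_range_sublevel {X : Type u} [TopologicalSpace X] {h : X → ℝ}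
    (hc : Continuous h) (hub : ∀ K : ℝ, ∃ x, K ≤ h x) :
    IsGammaFCover (range fun k : ℕ => {x | h x < k}) := by
  set V : ℕ → Set X := fun k => {x | h x < k} with hVdef
  have hV : ∀ k, V k ≠ univ := fun k hk => by
    obtain ⟨x, hx⟩ := hub k
    have : x ∈ V k := hk ▸ mem_univ x
    exact absurd hx (not_le.2 this)
  have hfin : ∀ (c : ℝ) x, {k : ℕ | ¬ h x + c < k}.Finite := fun c x => by
    refine (finite_Iic ⌊h x + c⌋₊).subset fun k hk => ?_
    exact Nat.le_floor (not_lt.1 hk)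
  have hγ : IsGammaCoverSets (range V) := by
    rw [← image_univ]
    refine isGammaCoverSets_image infinite_univ (fun k _ => hV k) fun x => ?_
    refine (hfin 0 x).subset fun k hk => ?_
    simpa [hVdef] using hk
  refine ⟨⟨?_, hγ⟩, ?_, fun W => {x | h x + 1 ≤ (V.invFun W : ℕ)}, ?_, ?_⟩
  · rintro _ ⟨k, rfl⟩
    exact isOpen_lt hc continuous_const
  · rintro _ ⟨k, rfl⟩
    have : (V k)ᶜ = {x | (k : ℝ) ≤ h x} := by ext; simp [hVdef]
    rw [IsCozeroSet, this]
    exact isZeroSet_setOf_le continuous_const hc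
  · intro W hW
    refine ⟨isZeroSet_setOf_le (by fun_prop) continuous_const, fun x hx => ?_⟩
    rw [← Function.invFun_eq hW]
    have : h x + 1 ≤ (V.invFun W : ℕ) := hx
    change h x < _
    linarith
  · have hinj : InjOn (Function.invFun V) (range V) := fun A hA B hB hAB => by
      rw [← Function.invFun_eq hA, ← Function.invFun_eq hB, hAB]
    refine isGammaCoverSets_image hγ.2.1 (fun W hW hun => ?_) fun x => ?_
    · obtain ⟨x, hx⟩ := hub (Function.invFun V W : ℕ)
      have : x ∈ {x | h x + 1 ≤ (V.invFun W : ℕ)} := hun ▸ mem_univ x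
      have : h x + 1 ≤ (V.invFun W : ℕ) := this
      linarith
    · refine Finite.of_finite_image ((hfin 1 x).subset ?_) (hinj.mono fun W hW => hW.1)
      rintro _ ⟨W, ⟨-, hW⟩, rfl⟩
      exact fun hlt => hW hlt.le

/-- A finite subfamily of an increasing sequence of sets has its union inside a single term. -/
theorem exists_subset_of_finite_subset_range {X : Type u} {V : ℕ → Set X} (hmono : Monotone V)
    {𝓕 : Set (Set X)} (hsub : 𝓕 ⊆ range V) (hfin : 𝓕.Finite) : ∃ k, ⋃₀ 𝓕 ⊆ V k := by
  choose! k hk using hsub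
  obtain ⟨N, hN⟩ := (hfin.image k).bddAbove
  refine ⟨N, ?_⟩
  rintro x ⟨A, hA, hx⟩
  rw [← hk hA] at hx
  exact hmono (hN (mem_image_of_mem k hA)) hx

theorem not_hasFinSubcover_range_of_monotone {X : Type u} {V : ℕ → Set X} (hmono : Monotone V)
    (hV : ∀ k, V k ≠ univ) : ¬ HasFinSubcover (range V) := by
  rintro ⟨𝓕, hsub, hfin, hcov⟩
  obtain ⟨k, hk⟩ := exists_subset_of_finite_subset_range hmono hsub hfin
  exact hV k (univ_subset_iff.1 (hcov ▸ hk))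

theorem HurewiczProperty.lindelofSpace {X : Type u} [TopologicalSpace X]
    (hX : HurewiczProperty X) : LindelofSpace X := by
  refine ⟨isLindelof_of_countable_subcover fun {ι} U hUo hcov => ?_⟩
  have huniv : ⋃₀ range U = univ := by
    rw [sUnion_range]
    exact univ_subset_iff.1 hcov
  obtain ⟨𝓕, h𝓕, hfin⟩ := hX (fun _ => range U) fun _ => ⟨by rintro _ ⟨i, rfl⟩; exact hUo i, huniv⟩
  rcases isEmpty_or_nonempty ι with hι | hι
  · exact ⟨∅, countable_empty, by simpa using hcov⟩
  choose! i hi using fun n => (h𝓕 n).1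
  refine ⟨⋃ n, i n '' 𝓕 n, countable_iUnion fun n => ((h𝓕 n).2.image _).countable, fun x _ => ?_⟩
  obtain ⟨n, hn⟩ := (hfin x).infinite_compl.nonempty
  obtain ⟨W, hW, hxW⟩ : x ∈ ⋃₀ 𝓕 n := not_not.1 hn
  exact mem_biUnion (mem_iUnion.2 ⟨n, mem_image_of_mem _ hW⟩) (by rwa [hi n hW])

theorem HurewiczProperty.ufinGammaFGamma {X : Type u} [TopologicalSpace X]
    (hX : HurewiczProperty X) : UfinGammaFGamma X := by
  intro 𝒰 h𝒰 hno
  obtain ⟨𝓕, h𝓕, hfin⟩ := hX 𝒰 fun n => ⟨(h𝒰 n).1.1, (h𝒰 n).1.2.2.2.1⟩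
  refine ⟨𝓕, h𝓕, ?_, ?_⟩
  · rintro _ ⟨n, rfl⟩
    exact isOpen_sUnion fun U hU => (h𝒰 n).1.1 U ((h𝓕 n).1 hU)
  · rw [← image_univ]
    exact isGammaCoverSets_image infinite_univ
      (fun n _ h => hno n ⟨𝓕 n, (h𝓕 n).1, (h𝓕 n).2, h⟩) fun x => by simpa using hfin x

theorem HurewiczProperty.of_ufinGammaFGamma {X : Type u} [TopologicalSpace X]
    [CompletelyRegularSpace X] [LindelofSpace X] (hX : UfinGammaFGamma X) :
    HurewiczProperty X := by
  intro 𝒰 h𝒰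
  choose h hc hnn hcov using fun n =>
    exists_continuous_sublevel_subset_sUnion (h𝒰 n).1 (h𝒰 n).2
  by_cases hb : ∀ n, ∃ K : ℝ, ∀ x, h n x < K
  · choose K hK using hb
    choose 𝓕 h𝓕 hfin hsub using fun n => hcov n (K n)
    refine ⟨𝓕, fun n => ⟨h𝓕 n, hfin n⟩, fun x => ?_⟩
    convert finite_empty
    exact eq_empty_of_forall_notMem fun n hn => hn (hsub n (hK n x))
  push Not at hb
  obtain ⟨m, hm⟩ := hb
  set H : ℕ → X → ℝ := fun n x => h m x + ∑ i ∈ Finset.range (n + 1), h i x with hH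
  have hHc : ∀ n, Continuous (H n) := fun n => by fun_prop
  have hHub : ∀ n K, ∃ x, K ≤ H n x := fun n K => by
    obtain ⟨x, hx⟩ := hm K
    exact ⟨x, hx.trans (le_add_of_nonneg_right (Finset.sum_nonneg fun i _ => hnn i x))⟩
  have hhH : ∀ i n, i ≤ n → ∀ x, h i x ≤ H n x := fun i n hin x => by
    have := Finset.single_le_sum (f := fun i => h i x) (fun j _ => hnn j x)
      (Finset.mem_range.2 (Nat.lt_succ_of_le hin))
    exact this.trans (le_add_of_nonneg_left (hnn m x))
  have hmono : ∀ n, Monotone fun k : ℕ => {x | H n x < k} := fun n a b hab x hx =>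
    show H n x < b from lt_of_lt_of_le hx (Nat.cast_le.2 hab)
  obtain ⟨𝒢, h𝒢, -, -, hinf, -, hpt⟩ := hX (fun n => range fun k : ℕ => {x | H n x < k})
    (fun n => isGammaFCover_range_sublevel (hHc n) (hHub n))
    (fun n => not_hasFinSubcover_range_of_monotone (hmono n) fun k hk => by
      obtain ⟨x, hx⟩ := hHub n k
      have : x ∈ {x | H n x < k} := hk ▸ mem_univ x
      exact absurd hx (not_le.2 this))
  obtain ⟨S, -, hS⟩ := exists_subset_bijOn (univ : Set ℕ) fun n => ⋃₀ 𝒢 n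
  have hSinf : S.Infinite := fun hfin => by
    rw [← image_univ, ← hS.image_eq] at hinf
    exact hinf (hfin.image _)
  have hφ : StrictMono (Nat.nth (· ∈ S)) := Nat.nth_strictMono hSinf
  choose K hK using fun n => exists_subset_of_finite_subset_range (hmono n) (h𝒢 n).1 (h𝒢 n).2
  choose 𝓕 h𝓕 hfin hsub using fun n => hcov n (K (Nat.nth (· ∈ S) n))
  refine ⟨𝓕, fun n => ⟨h𝓕 n, hfin n⟩, fun x => ?_⟩
  have hinj : Function.Injective fun n => ⋃₀ 𝒢 (Nat.nth (· ∈ S) n) := fun a b hab =>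
    hφ.injective (hS.injOn (Nat.nth_mem_of_infinite hSinf a) (Nat.nth_mem_of_infinite hSinf b) hab)
  refine Finite.of_finite_image ((hpt x).subset ?_) hinj.injOn
  rintro _ ⟨n, hn, rfl⟩
  exact ⟨⟨_, rfl⟩, fun hx => hn (hsub n ((hhH _ _ (hφ.le_apply) x).trans_lt (hK _ hx)))⟩

/-- Theorem 4.1: for a Tychonoff space `X`, `X` is Lindelöf and satisfies
`U_fin(Γ_F, Γ)` iff `X` has the Hurewicz property. -/
theorem stmt5 (X : Type u) [TopologicalSpace X] [CompletelyRegularSpace X] [T2Space X] :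
    (LindelofSpace X ∧ UfinGammaFGamma X) ↔ HurewiczProperty X := by
  refine ⟨?_, fun h => ⟨h.lindelofSpace, h.ufinGammaFGamma⟩⟩
  rintro ⟨hL, hU⟩
  exact HurewiczProperty.of_ufinGammaFGamma hU
end

section
/- For a Lindelöf Tychonoff space X, the following are equivalent: (1) C_p(X) satisfies F_fin(Γ_0, Γ_0); (2) X has the Hurewicz property. -/
open Set Filter Topology

universe u

/-- A pointwise null sequence of nonzero continuous functions enumerates a member of `Γ_0`. -/
theorem gammaZero_range {X : Type u} [TopologicalSpace X] {f : ℕ → X → ℝ}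
    (hc : ∀ m, Continuous (f m)) (h0 : ∀ m, f m ≠ 0) (hf : Tendsto f atTop (𝓝 0)) :
    GammaZero (range f) := by
  have key : ∀ U ∈ 𝓝 (0 : X → ℝ), {m | f m ∉ U}.Finite := by
    intro U hU
    have h : ∀ᶠ m in cofinite, f m ∈ U := by
      rw [Nat.cofinite_eq_atTop]
      exact hf hU
    exact h
  refine ⟨countable_range f, ?_, ?_, ?_, ?_⟩
  · rintro _ ⟨m, rfl⟩
    exact hc m
  · rintro ⟨m, hm⟩
    exact h0 m hm
  · intro hfin
    have hU : (range f)ᶜ ∈ 𝓝 (0 : X → ℝ) :=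
      hfin.isClosed.isOpen_compl.mem_nhds fun ⟨m, hm⟩ => h0 m hm
    exact infinite_univ ((key _ hU).subset fun m _ => not_not_intro (mem_range_self m))
  · intro U hU
    refine ((key U hU).image f).subset ?_
    rintro _ ⟨⟨m, rfl⟩, hm⟩
    exact ⟨m, hm, rfl⟩

/-- In a nonempty Lindelöf completely regular space, every open cover is refined by a countable
cover consisting of cozero-sets of nonnegative functions. -/
theorem exists_seq_cozero_refinement {X : Type u} [TopologicalSpace X] [CompletelyRegularSpace X]
    [LindelofSpace X] [Nonempty X] {𝒰 : Set (Set X)} (ho : ∀ U ∈ 𝒰, IsOpen U)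
    (hcov : ⋃₀ 𝒰 = (univ : Set X)) :
    ∃ (U : ℕ → Set X) (g : ℕ → X → ℝ), (∀ k, U k ∈ 𝒰) ∧ (∀ k, Continuous (g k)) ∧
      (∀ k x, 0 ≤ g k x) ∧ (∀ k, ∀ x ∉ U k, g k x = 0) ∧ ∀ x, ∃ k, 0 < g k x := by
  have hpt : ∀ x : X, ∃ (U : Set X) (g : X → ℝ), U ∈ 𝒰 ∧ Continuous g ∧
      (∀ y, 0 ≤ g y) ∧ (∀ y ∉ U, g y = 0) ∧ 0 < g x := by
    intro x
    obtain ⟨U, hU, hx⟩ : x ∈ ⋃₀ 𝒰 := hcov ▸ mem_univ x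
    obtain ⟨f, hf, hfx, hfU⟩ := CompletelyRegularSpace.completely_regular x Uᶜ
      (ho U hU).isClosed_compl (not_not_intro hx)
    refine ⟨U, fun y => 1 - (f y : ℝ), hU, by fun_prop, fun y => ?_, fun y hy => ?_, ?_⟩
    · exact sub_nonneg.2 (f y).2.2
    · simp [hfU hy]
    · simp [hfx]
  choose U g hU hg hg0 hgU hgx using hpt
  obtain ⟨t, ht, hcover⟩ := LindelofSpace.elim_nhds_subcover (fun x => {y | 0 < g x y})
    fun x => (isOpen_lt continuous_const (hg x)).mem_nhds (hgx x)
  have hmem : ∀ x, ∃ i ∈ t, 0 < g i x := by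
    intro x
    have hx : x ∈ ⋃ i ∈ t, {y | 0 < g i y} := hcover ▸ mem_univ x
    simpa using hx
  have hne : t.Nonempty := by
    obtain ⟨i, hi, -⟩ := hmem (Classical.arbitrary X)
    exact ⟨i, hi⟩
  obtain ⟨e, rfl⟩ := ht.exists_eq_range hne
  refine ⟨fun k => U (e k), fun k => g (e k), fun k => hU _, fun k => hg _, fun k => hg0 _,
    fun k => hgU _, fun x => ?_⟩
  obtain ⟨_, ⟨k, rfl⟩, hk⟩ := hmem x
  exact ⟨k, hk⟩

/-- If the cozero-sets of the nonnegative functions `g k` cover `X`, some member of `Γ_0` is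
enumerated by functions that are at least `1` off the union of the first cozero-sets. -/
theorem exists_gammaZero_range {X : Type u} [TopologicalSpace X] [Nonempty X] {g : ℕ → X → ℝ}
    (hc : ∀ k, Continuous (g k)) (hg : ∀ k x, 0 ≤ g k x) (hcov : ∀ x, ∃ k, 0 < g k x) :
    ∃ f : ℕ → X → ℝ, GammaZero (range f) ∧
      ∀ m x, |f m x| < 1 → ∃ k ≤ m, g k x ≠ 0 := by
  let f : ℕ → X → ℝ := fun m x =>
    max 0 (1 - (m : ℝ) * ∑ k ∈ Finset.range (m + 1), g k x) + 1 / ((m : ℝ) + 1)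
  have hpos : ∀ m x, 0 < f m x := fun m x =>
    add_pos_of_nonneg_of_pos (le_max_left _ _) Nat.one_div_pos_of_nat
  refine ⟨f, gammaZero_range (fun m => ?_) (fun m h => ?_) ?_, fun m x hx => ?_⟩
  · fun_prop
  · exact (hpos m (Classical.arbitrary X)).ne' (congrFun h _)
  · rw [tendsto_pi_nhds]
    intro x
    obtain ⟨k, hk⟩ := hcov x
    obtain ⟨N, hN⟩ := exists_nat_gt (1 / g k x)
    refine (tendsto_one_div_add_atTop_nhds_zero_nat (𝕜 := ℝ)).congr' ?_
    filter_upwards [eventually_ge_atTop N, eventually_ge_atTop k] with m hmN hmk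
    have hsum : g k x ≤ ∑ i ∈ Finset.range (m + 1), g i x :=
      Finset.single_le_sum (f := fun i => g i x) (fun i _ => hg i x)
        (Finset.mem_range.2 (Nat.lt_succ_of_le hmk))
    have hm : 1 / g k x ≤ m := hN.le.trans (by exact_mod_cast hmN)
    have hone : 1 ≤ (m : ℝ) * ∑ i ∈ Finset.range (m + 1), g i x :=
      ((div_le_iff₀ hk).1 hm).trans (mul_le_mul_of_nonneg_left hsum m.cast_nonneg)
    simp only [f]
    rw [max_eq_left (sub_nonpos.2 hone), zero_add]
  · by_contra! h
    have hsum : ∑ k ∈ Finset.range (m + 1), g k x = 0 :=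
      Finset.sum_eq_zero fun k hk => h k (Nat.lt_succ_iff.1 (Finset.mem_range.1 hk))
    have hd : 0 < 1 / ((m : ℝ) + 1) := Nat.one_div_pos_of_nat
    have hfx : f m x = 1 + 1 / ((m : ℝ) + 1) := by simp [f, hsum]
    rw [abs_of_pos (hpos m x), hfx] at hx
    linarith

/-- The Hurewicz property of `X` implies `F_fin(Γ_0, Γ_0)` for `C_p(X)`. -/
theorem HurewiczProperty.ffinGammaGamma {X : Type u} [TopologicalSpace X]
    (hX : HurewiczProperty X) : FfinGammaGamma X := by
  intro S hS
  let V : ℕ → (X → ℝ) → Set X := fun n h => {x | |h x| < 1 / ((n : ℝ) + 1)}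
  have hcov : ∀ n, (∀ U ∈ V n '' S n, IsOpen U) ∧ ⋃₀ (V n '' S n) = (univ : Set X) := by
    intro n
    obtain ⟨-, hcont, -, hinf, hconv⟩ := hS n
    refine ⟨?_, eq_univ_of_forall fun x => ?_⟩
    · rintro _ ⟨h, hh, rfl⟩
      exact isOpen_lt (hcont h hh).abs continuous_const
    · have hW : {h : X → ℝ | |h x| < 1 / ((n : ℝ) + 1)} ∈ 𝓝 (0 : X → ℝ) := by
        refine (isOpen_lt (continuous_apply x).abs continuous_const).mem_nhds ?_
        simpa using (Nat.one_div_pos_of_nat : 0 < 1 / ((n : ℝ) + 1))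
      obtain ⟨h, hh, hhW⟩ := (hinf.sdiff (hconv _ hW)).nonempty
      exact ⟨V n h, mem_image_of_mem _ hh, by_contra fun hx => hhW ⟨hh, hx⟩⟩
  obtain ⟨𝓕, h𝓕, hfin⟩ := hX _ hcov
  choose F hFS hFfin hF using fun n => (h𝓕 n).2.exists_subset_finite_image_eq (h𝓕 n).1
  refine ⟨F, fun n => ⟨hFS n, hFfin n⟩, fun ε hε K hK => ?_⟩
  have hmem : ∀ᶠ n in atTop, ∀ x ∈ K, x ∈ ⋃₀ 𝓕 n := by
    rw [← Nat.cofinite_eq_atTop, hK.eventually_all]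
    exact fun x _ => hfin x
  have hsmall : ∀ᶠ n : ℕ in atTop, 1 / ((n : ℝ) + 1) < ε :=
    tendsto_one_div_add_atTop_nhds_zero_nat.eventually_lt_const hε
  obtain ⟨N, hN⟩ := eventually_atTop.1 (hmem.and hsmall)
  refine ⟨N, fun n hn x hx => ?_⟩
  obtain ⟨hn𝓕, hnε⟩ := hN n hn.le
  have hx𝓕 := hn𝓕 x hx
  rw [← hF n] at hx𝓕
  obtain ⟨_, ⟨h, hh, rfl⟩, hxh⟩ := hx𝓕
  exact ⟨h, hh, lt_trans hxh hnε⟩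

/-- In a Lindelöf completely regular space, `F_fin(Γ_0, Γ_0)` implies the Hurewicz property. -/
theorem FfinGammaGamma.hurewiczProperty {X : Type u} [TopologicalSpace X]
    [CompletelyRegularSpace X] [LindelofSpace X] (hX : FfinGammaGamma X) :
    HurewiczProperty X := by
  intro 𝒰 h𝒰
  rcases isEmpty_or_nonempty X with _ | _
  · exact ⟨fun _ => ∅, fun n => ⟨empty_subset _, finite_empty⟩, isEmptyElim⟩
  choose U g hU hgc hg0 hgU hgcov using fun n =>
    exists_seq_cozero_refinement (h𝒰 n).1 (h𝒰 n).2
  choose f hfΓ hf using fun n => exists_gammaZero_range (hgc n) (hg0 n) (hgcov n)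
  obtain ⟨F, hFS, hF⟩ := hX (fun n => range (f n)) hfΓ
  choose M _ hMfin hM using fun n =>
    (hFS n).2.exists_subset_finite_image_eq ((hFS n).1.trans image_univ.superset)
  refine ⟨fun n => ⋃ m ∈ M n, U n '' Iic m, fun n => ⟨?_, ?_⟩, fun x => ?_⟩
  · refine iUnion₂_subset fun m _ => ?_
    rintro _ ⟨k, -, rfl⟩
    exact hU n k
  · exact (hMfin n).biUnion fun m _ => (finite_Iic m).image _
  · obtain ⟨N, hN⟩ := hF 1 one_pos {x} (finite_singleton x)
    refine (finite_Iic N).subset fun n hn => mem_Iic.2 <| not_lt.1 fun hlt => hn ?_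
    obtain ⟨h, hh, hhx⟩ := hN n hlt x rfl
    rw [← hM n] at hh
    obtain ⟨m, hm, rfl⟩ := hh
    obtain ⟨k, hkm, hk⟩ := hf n m x hhx
    exact ⟨U n k, mem_biUnion hm (mem_image_of_mem _ hkm), by_contra fun hx => hk (hgU n k x hx)⟩

/-- Theorem 4.3: for a Lindelöf Tychonoff space `X`, `C_p(X)` satisfies
`F_fin(Γ_0, Γ_0)` iff `X` has the Hurewicz property. -/
theorem stmt7 (X : Type u) [TopologicalSpace X] [CompletelyRegularSpace X] [T2Space X]
    [LindelofSpace X] :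
    FfinGammaGamma X ↔ HurewiczProperty X := by
  exact ⟨FfinGammaGamma.hurewiczProperty, HurewiczProperty.ffinGammaGamma⟩
end
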